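/- Let ℓ : W → H be a continuous map satisfying ℓ(δ_λ A) = δ_λ ℓ(A) for all A ∈ W and all λ ≥ 0, and ℓ(A·B) = ℓ(A)·ℓ(ℓ(A)⁻¹·B·ℓ(A)) for all A, B ∈ W (i.e. ℓ is intrinsic linear, W being normal in G). Then: (i) ℓ(i(a,α)) does not depend on the vertical component α ∈ ℝⁿ; (ii) identifying H with ℝᵏ via (x₁,…,x_k,0,…,0) ↦ (x₁,…,x_k), the map a ↦ ℓ(i(a,0)) from ℝ^{m−k} to ℝᵏ is ℝ-linear; (iii) there is a constant C_L ≥ 0 such that |ℓ(i(a,α))|_{ℝᵏ} ≤ C_L·|a|_{ℝ^{m−k}} for all (a,α) ∈ ℝ^{m−k} × ℝⁿ. -/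

import Mathlib

noncomputable section

open Set Filter Topology MeasureTheory

namespace Carnot

/-- Euclidean norm on `Fin d → ℝ`. -/
def enorm {d : ℕ} (x : Fin d → ℝ) : ℝ := Real.sqrt (∑ i, (x i) ^ 2)

/-- The underlying set of the Carnot group `G = ℝ^m × ℝ^n` of class `𝓑`. -/
abbrev G (m n : ℕ) := (Fin m → ℝ) × (Fin n → ℝ)

/-- Points of the normal complement `W`, identified with `ℝ^(m-k) × ℝ^n`. -/
abbrev W (m n k : ℕ) := (Fin (m - k) → ℝ) × (Fin n → ℝ)

/-- The group law of the Carnot group of class `𝓑` associated with the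
skew-symmetric matrices `b s`:
`(x,y)·(x',y') = (x + x', y + y' + ½⟨Bx,x'⟩)`. -/
def gmul {m n : ℕ} (b : Fin n → Matrix (Fin m) (Fin m) ℝ) (P Q : G m n) : G m n :=
  (P.1 + Q.1, fun s => P.2 s + Q.2 s + (1 / 2) * ∑ i, ∑ j, b s i j * P.1 j * Q.1 i)

/-- The group inverse `(x,y)⁻¹ = (-x,-y)`. -/
def ginv {m n : ℕ} (P : G m n) : G m n := (-P.1, -P.2)

/-- The homogeneous quasi-norm `N(x,y) = |x| + |y|^(1/2)`. -/
def qnorm {m n : ℕ} (P : G m n) : ℝ := enorm P.1 + Real.sqrt (enorm P.2)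

/-- Open ball for the quasi-norm: `U(P,r) = {Q : N(P⁻¹·Q) < r}`. -/
def ball (m n : ℕ) (b : Fin n → Matrix (Fin m) (Fin m) ℝ) (P : G m n) (r : ℝ) : Set (G m n) :=
  {Q | qnorm (gmul b (ginv P) Q) < r}

/-- The embedding `i : ℝ^(m-k) × ℝ^n → G`, `i(a,α) = (0,…,0,a,α)`. -/
def embW (m n k : ℕ) (A : W m n k) : G m n :=
  (fun j => if h : (j : ℕ) < k then 0 else A.1 ⟨(j : ℕ) - k, by have := j.isLt; omega⟩, A.2)

/-- The embedding of `ℝ^k` as the horizontal subgroup `H`, `v ↦ (v,0,…,0)`. -/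
def embH (m n k : ℕ) (v : Fin k → ℝ) : G m n :=
  (fun j => if h : (j : ℕ) < k then v ⟨(j : ℕ), h⟩ else 0, 0)

/-- The graph map `Φ(A) = i(A)·φ̂(A)`. -/
def graphMap (m n k : ℕ) (b : Fin n → Matrix (Fin m) (Fin m) ℝ)
    (φ : W m n k → Fin k → ℝ) (A : W m n k) : G m n :=
  gmul b (embW m n k A) (embH m n k (φ A))

/-- `N(i(A)⁻¹·i(B))`. -/
def dW (m n k : ℕ) (b : Fin n → Matrix (Fin m) (Fin m) ℝ) (A B : W m n k) : ℝ :=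
  qnorm (gmul b (ginv (embW m n k A)) (embW m n k B))

/-- The graph quasi-distance `σ_φ(A,B) = N(φ̂(A)⁻¹·i(A)⁻¹·i(B)·φ̂(A))`. -/
def sigma (m n k : ℕ) (b : Fin n → Matrix (Fin m) (Fin m) ℝ)
    (φ : W m n k → Fin k → ℝ) (A B : W m n k) : ℝ :=
  qnorm (gmul b (gmul b (gmul b (ginv (embH m n k (φ A))) (ginv (embW m n k A)))
    (embW m n k B)) (embH m n k (φ A)))

/-- The matrix `M` satisfies the uniform intrinsic differentiability condition of `φ`
at `A₀ ∈ 𝒪`. -/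
def UID (m n k : ℕ) (b : Fin n → Matrix (Fin m) (Fin m) ℝ) (O : Set (W m n k))
    (φ : W m n k → Fin k → ℝ) (A₀ : W m n k) (M : Matrix (Fin k) (Fin (m - k)) ℝ) : Prop :=
  ∀ ε > 0, ∃ r > 0, ∀ A ∈ O, ∀ B ∈ O,
    dW m n k b A₀ A < r → dW m n k b A B < r → 0 < dW m n k b A B →
    enorm (fun j => φ B j - φ A j - ∑ i, M j i * (B.1 i - A.1 i)) ≤ ε * sigma m n k b φ A B

/-- `f : U → ℝ^k` is of class `C¹_G` with (continuous) horizontal Jacobian `gradf`. -/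
def C1G (m n k : ℕ) (b : Fin n → Matrix (Fin m) (Fin m) ℝ) (U : Set (G m n))
    (f : G m n → Fin k → ℝ) (gradf : G m n → Matrix (Fin k) (Fin m) ℝ) : Prop :=
  ContinuousOn f U ∧ ContinuousOn gradf U ∧
  ∀ P ∈ U, ∀ ε > 0, ∃ r > 0, ∀ Q ∈ U,
    qnorm (gmul b (ginv P) Q) < r →
    enorm (fun j => f Q j - f P j - ∑ i, gradf P j i * (Q.1 i - P.1 i)) ≤
      ε * qnorm (gmul b (ginv P) Q)

/-- The square block `M₁(Q) = (X_i f_j(Q))_{j,i=1,…,k}` of the horizontal Jacobian. -/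
def M1 (m n k : ℕ) (hk : k ≤ m) (gradf : G m n → Matrix (Fin k) (Fin m) ℝ) (Q : G m n) :
    Matrix (Fin k) (Fin k) ℝ :=
  Matrix.of fun j i => gradf Q j (Fin.castLE hk i)

/-- The block `M₂(Q) = (X_{k+i} f_j(Q))_{j=1,…,k; i=1,…,m-k}` of the horizontal Jacobian. -/
def M2 (m n k : ℕ) (gradf : G m n → Matrix (Fin k) (Fin m) ℝ) (Q : G m n) :
    Matrix (Fin k) (Fin (m - k)) ℝ :=
  Matrix.of fun j i => gradf Q j ⟨k + (i : ℕ), by have := i.isLt; omega⟩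

/-- The projection `G → ℝ^(m-k) × ℝ^n` recovering the `W`-coordinates. -/
def projW (m n k : ℕ) (P : G m n) : W m n k :=
  (fun i => P.1 ⟨k + (i : ℕ), by have := i.isLt; omega⟩, P.2)

theorem enorm_eq_norm_toLp {d : ℕ} (x : Fin d → ℝ) : enorm x = ‖WithLp.toLp 2 x‖ := by
  simp [enorm, EuclideanSpace.norm_eq]

theorem embW_fst_zero (m n k : ℕ) (α : Fin n → ℝ) : (embW m n k (0, α)).1 = 0 := by
  ext j
  simp [embW]

/-- The first `W`-coordinates of a product of elements of `W` add up. -/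
theorem projW_gmul_embW_fst (m n k : ℕ) (b : Fin n → Matrix (Fin m) (Fin m) ℝ)
    (A B : W m n k) :
    (projW m n k (gmul b (embW m n k A) (embW m n k B))).1 = A.1 + B.1 := by
  ext i
  simp [projW, gmul, embW]

theorem projW_gmul_embW_zero (m n k : ℕ) (b : Fin n → Matrix (Fin m) (Fin m) ℝ)
    (α : Fin n → ℝ) (B : W m n k) :
    projW m n k (gmul b (embW m n k (0, α)) (embW m n k B)) = (B.1, α + B.2) := by
  refine Prod.ext ?_ ?_
  · rw [projW_gmul_embW_fst, zero_add]
  · ext s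
    simp only [projW, gmul, embW_fst_zero]
    simp [embW]

/-- Conjugation by an element of `H` preserves the first `W`-coordinates. -/
theorem projW_conj_fst (m n k : ℕ) (b : Fin n → Matrix (Fin m) (Fin m) ℝ)
    (v : Fin k → ℝ) (B : W m n k) :
    (projW m n k (gmul b (gmul b (ginv (embH m n k v)) (embW m n k B)) (embH m n k v))).1
      = B.1 := by
  ext i
  simp [projW, gmul, embW, embH, ginv]

theorem projW_conj_zero (m n k : ℕ) (b : Fin n → Matrix (Fin m) (Fin m) ℝ) (B : W m n k) :
    projW m n k (gmul b (gmul b (ginv (embH m n k 0)) (embW m n k B)) (embH m n k 0)) = B := by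
  refine Prod.ext (projW_conj_fst m n k b 0 B) ?_
  ext s
  simp [projW, gmul, embW, embH, ginv]

/-- Conjugation by elements of `H` fixes the vertical elements of `W`. -/
theorem projW_conj_vertical (m n k : ℕ) (b : Fin n → Matrix (Fin m) (Fin m) ℝ)
    (hblock : ∀ s (i j : Fin m), (i : ℕ) < k → (j : ℕ) < k → b s i j = 0)
    (v : Fin k → ℝ) (β : Fin n → ℝ) :
    projW m n k (gmul b (gmul b (ginv (embH m n k v)) (embW m n k (0, β))) (embH m n k v))
      = (0, β) := by
  refine Prod.ext (projW_conj_fst m n k b v (0, β)) ?_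
  ext s
  have h : ∀ i j : Fin m, b s i j * (embH m n k v).1 j * (embH m n k v).1 i = 0 := by
    intro i j
    by_cases hi : (i : ℕ) < k
    · by_cases hj : (j : ℕ) < k
      · simp [hblock s i j hi hj]
      · simp [embH, hj]
    · simp [embH, hi]
  simp only [projW, gmul, embW_fst_zero]
  simp [ginv, h]
  simp [embW]

/-- If `ℓ : W → H` is continuous, homogeneous with respect to the
dilations and satisfies `ℓ(A·B) = ℓ(A)·ℓ(ℓ(A)⁻¹·B·ℓ(A))` (i.e. `ℓ` is intrinsic
linear), then `ℓ` does not depend on the vertical variables, `a ↦ ℓ(a,0)` is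
`ℝ`-linear and `|ℓ(a,α)| ≤ C_L |a|` for some `C_L ≥ 0`. -/
theorem statement0 (m n k : ℕ) (hm : 2 ≤ m) (hn : 1 ≤ n) (hk : 1 ≤ k) (hkm : k < m)
    (b : Fin n → Matrix (Fin m) (Fin m) ℝ)
    (hskew : ∀ s, (b s).transpose = -(b s)) (hind : LinearIndependent ℝ b)
    (hblock : ∀ s (i j : Fin m), (i : ℕ) < k → (j : ℕ) < k → b s i j = 0)
    (ℓ : W m n k → Fin k → ℝ) (hcont : Continuous ℓ)
    (hdil : ∀ lam : ℝ, 0 ≤ lam → ∀ A : W m n k,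
      ℓ (lam • A.1, (lam ^ 2) • A.2) = lam • ℓ A)
    (hmul : ∀ A B : W m n k,
      ℓ (projW m n k (gmul b (embW m n k A) (embW m n k B))) =
        ℓ A + ℓ (projW m n k
          (gmul b (gmul b (ginv (embH m n k (ℓ A))) (embW m n k B)) (embH m n k (ℓ A))))) :
    (∀ (a : Fin (m - k) → ℝ) (α α' : Fin n → ℝ), ℓ (a, α) = ℓ (a, α')) ∧
    IsLinearMap ℝ (fun a : Fin (m - k) → ℝ => ℓ (a, 0)) ∧
    (∃ C : ℝ, 0 ≤ C ∧ ∀ (a : Fin (m - k) → ℝ) (α : Fin n → ℝ),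
      enorm (ℓ (a, α)) ≤ C * enorm a) := by
  have hadd0 : ∀ α β : Fin n → ℝ, ℓ (0, α + β) = ℓ (0, α) + ℓ (0, β) := by
    intro α β
    simpa only [projW_gmul_embW_zero, projW_conj_vertical m n k b hblock] using
      hmul (0, α) (0, β)
  have hvert : ∀ α : Fin n → ℝ, ℓ (0, α) = 0 := by
    intro α
    have h := hdil 2 zero_le_two (0, α)
    have h4 : (2 ^ 2 : ℝ) • α = (α + α) + (α + α) := by
      ext s
      simp only [Pi.smul_apply, Pi.add_apply, smul_eq_mul]
      ring
    simp only [smul_zero, h4, hadd0] at h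
    ext j
    have hj := congrFun h j
    simp only [Pi.add_apply, Pi.smul_apply, smul_eq_mul] at hj
    simp only [Pi.zero_apply]
    linarith
  have hindep : ∀ (a : Fin (m - k) → ℝ) (α : Fin n → ℝ), ℓ (a, α) = ℓ (a, 0) := by
    intro a α
    simpa only [projW_gmul_embW_zero, hvert, projW_conj_zero, add_zero, zero_add] using
      hmul (0, α) (a, 0)
  have hfst : ∀ A : W m n k, ℓ A = ℓ (A.1, 0) := fun A => hindep A.1 A.2
  have hadd : ∀ x y : Fin (m - k) → ℝ, ℓ (x + y, 0) = ℓ (x, 0) + ℓ (y, 0) := by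
    intro x y
    have h := hmul (x, 0) (y, 0)
    rwa [hfst (projW _ _ _ _), projW_gmul_embW_fst, hfst (projW _ _ _ (gmul _ (gmul _ _ _) _)),
      projW_conj_fst] at h
  have hsmul : ∀ (c : ℝ) (x : Fin (m - k) → ℝ), ℓ (c • x, 0) = c • ℓ (x, 0) := by
    have hpos : ∀ (c : ℝ), 0 ≤ c → ∀ x : Fin (m - k) → ℝ, ℓ (c • x, 0) = c • ℓ (x, 0) := by
      intro c hc x
      simpa only [smul_zero] using hdil c hc (x, 0)
    intro c x
    rcases le_total 0 c with hc | hc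
    · exact hpos c hc x
    · have h := hadd (c • x) ((-c) • x)
      rw [← add_smul, add_neg_cancel, zero_smul, hvert, hpos (-c) (neg_nonneg.2 hc), neg_smul,
        ← sub_eq_add_neg] at h
      exact sub_eq_zero.1 h.symm
  have hlin : IsLinearMap ℝ (fun a : Fin (m - k) → ℝ => ℓ (a, 0)) := ⟨hadd, hsmul⟩
  refine ⟨fun a α α' => (hindep a α).trans (hindep a α').symm, hlin, ?_⟩
  let L : EuclideanSpace ℝ (Fin (m - k)) →L[ℝ] EuclideanSpace ℝ (Fin k) :=
    LinearMap.toContinuousLinearMap ((WithLp.linearEquiv 2 ℝ (Fin k → ℝ)).symm.toLinearMap ∘ₗ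
      hlin.mk' _ ∘ₗ (WithLp.linearEquiv 2 ℝ (Fin (m - k) → ℝ)).toLinearMap)
  refine ⟨‖L‖, norm_nonneg L, fun a α => ?_⟩
  rw [hindep, enorm_eq_norm_toLp, enorm_eq_norm_toLp]
  exact L.le_opNorm (WithLp.toLp 2 a)

end Carnot
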